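/- arXiv:2410.21460 — 2 statements merged into one kernel-verified Lean document; each statement's English description precedes it below -/
import Mathlib

section
/- Let H : ℝ² → ℝ² be defined by H(v) = ‖v‖ • v, where ‖·‖ is the Euclidean norm. Then: H is a bijection and a homeomorphism of ℝ²; both H and its inverse map every simple closed C¹ curve to a simple closed C¹ curve (so H ∈ Homeo¹(ℝ²)); H is differentiable at 0 with derivative the zero linear map; and the inverse of H is not differentiable at 0. In particular H ∈ Homeo¹(ℝ²) but H is not a C¹ diffeomorphism of ℝ². -/
open Filter Topology

noncomputable section

abbrev Plane : Type := ℝ × ℝ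

abbrev ProjLine : Type := Projectivization ℝ Plane

instance : TopologicalSpace ProjLine := instTopologicalSpaceQuotient

/-- A regular (C¹, 1-periodic, injective on `[0,1)`, nowhere-vanishing derivative)
parameterization of a simple closed C¹ curve. -/
def IsRegParam (γ : ℝ → Plane) : Prop :=
  ContDiff ℝ 1 γ ∧ Function.Periodic γ 1 ∧ Set.InjOn γ (Set.Ico 0 1) ∧ ∀ t, deriv γ t ≠ 0

/-- `Γ` is a simple closed C¹ curve. -/
def IsC1Curve (Γ : Set Plane) : Prop := ∃ γ : ℝ → Plane, IsRegParam γ ∧ Γ = Set.range γ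

/-- `Γ` is a simple closed C¹ curve through `p` with tangent line `ℓ` at `p`. -/
def TangentAt (Γ : Set Plane) (p : Plane) (ℓ : ProjLine) : Prop :=
  ∃ (γ : ℝ → Plane) (t₀ : ℝ) (h : IsRegParam γ),
    Γ = Set.range γ ∧ γ t₀ = p ∧ ℓ = Projectivization.mk ℝ (deriv γ t₀) (h.2.2.2 t₀)

/-- `f` maps every simple closed C¹ curve to a simple closed C¹ curve. -/
def MapsC1 (f : Plane → Plane) : Prop := ∀ Γ : Set Plane, IsC1Curve Γ → IsC1Curve (f '' Γ)

/-- Membership in `Homeo¹(ℝ²)`. -/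
def InHomeo1 (f : Plane ≃ₜ Plane) : Prop := MapsC1 ⇑f ∧ MapsC1 ⇑f.symm

/-- `φ` is a homeomorphism of projective tangent spaces induced by `f` at `p`. -/
def InducesAt (f : Plane → Plane) (p : Plane) (φ : ProjLine ≃ₜ ProjLine) : Prop :=
  ∀ (Γ : Set Plane) (ℓ : ProjLine), TangentAt Γ p ℓ →
    IsC1Curve (f '' Γ) ∧ TangentAt (f '' Γ) (f p) (φ ℓ)

/-- The secant direction from `q` to `x` (junk value if `x = q`). -/
def secantDir (q x : Plane) : ProjLine :=
  if h : x = q then Projectivization.mk ℝ (1, 0) (by simp) else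
    Projectivization.mk ℝ (x - q) (sub_ne_zero.mpr h)

/-- The sequence `x` converges along the line `ℓ` to `p`. -/
def ConvAlong (p : Plane) (ℓ : ProjLine) (x : ℕ → Plane) : Prop :=
  (∀ n, x n ≠ p) ∧ Tendsto x atTop (𝓝 p) ∧
    Tendsto (fun n => secantDir p (x n)) atTop (𝓝 ℓ)

/-- `(x, k)` is a transverse sequence for `(p, ℓ)`. -/
def TransverseFor (p : Plane) (ℓ : ProjLine) (x : ℕ → Plane) (k : ℕ → ProjLine) : Prop :=
  ConvAlong p ℓ x ∧
    ∀ φ : ℕ → ℕ, StrictMono φ →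
      ¬ Tendsto (fun n => (x (φ n), k (φ n))) atTop (𝓝 (p, ℓ))

/-- `(x, k)` is a transverse sequence. -/
def Transverse (x : ℕ → Plane) (k : ℕ → ProjLine) : Prop := ∃ p ℓ, TransverseFor p ℓ x k

section Reparametrization

open MeasureTheory

variable {E : Type*} [NormedAddCommGroup E] [NormedSpace ℝ E]

/-- A continuous curve whose derivative exists off a countable set, and is there the restriction
of a continuous function, is differentiable everywhere. -/
theorem hasDerivAt_of_continuous_of_countable [CompleteSpace E] {F T : ℝ → E} {Z : Set ℝ}
    (hZ : Z.Countable) (hF : Continuous F) (hT : Continuous T)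
    (hd : ∀ t ∉ Z, HasDerivAt F (T t) t) (t : ℝ) : HasDerivAt F (T t) t := by
  have key : F = fun u => F 0 + ∫ x in (0 : ℝ)..u, T x := by
    funext u
    rw [integral_eq_of_hasDerivAt_off_countable F T hZ hF.continuousOn
      (fun x hx => hd x hx.2) (hT.intervalIntegrable 0 u)]
    abel
  rw [key]
  exact (intervalIntegral.integral_hasDerivAt_right (hT.intervalIntegrable 0 t)
    hT.aestronglyMeasurable.stronglyMeasurableAtFilter hT.continuousAt).const_add (F 0)

/-- The speed of a continuous curve with continuous nonvanishing direction is locally integrable. -/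
theorem locallyIntegrable_of_hasDerivAt_smul {F T : ℝ → E} {ρ : ℝ → ℝ} {Z : Set ℝ}
    (hZ : ∀ x, ∀ᶠ t in 𝓝[≠] x, t ∉ Z) (hF : Continuous F) (hT : Continuous T)
    (hT0 : ∀ t, T t ≠ 0) (hρ : ∀ t, 0 < ρ t) (hd : ∀ t ∉ Z, HasDerivAt F (ρ t • T t) t) :
    LocallyIntegrable ρ := by
  intro x
  obtain ⟨L, hL⟩ := SeparatingDual.exists_eq_one (R := ℝ) (hT0 x)
  have hLT : Continuous fun t => L (T t) := L.continuous.comp hT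
  have hpos : ∀ᶠ t in 𝓝 x, 0 < L (T t) :=
    hLT.continuousAt.eventually (lt_mem_nhds (by simp [hL]))
  obtain ⟨ε, hε, hball⟩ := Metric.eventually_nhds_iff.1
    (hpos.and (eventually_nhdsWithin_iff.1 (hZ x)))
  have hIoc : ∀ a b, x - ε < a → b < x + ε → x ∉ Set.Ioo a b → IntegrableOn ρ (Set.Ioc a b) := by
    intro a b ha hb hx
    have hmem : ∀ t ∈ Set.Icc a b, dist t x < ε := fun t ht => by
      rw [Real.dist_eq, abs_lt]
      constructor <;> linarith [ht.1, ht.2]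
    have hint : IntegrableOn (fun t => ρ t * L (T t)) (Set.Ioc a b) := by
      refine intervalIntegral.integrableOn_deriv_of_nonneg (g := fun t => L (F t))
        (L.continuous.comp hF).continuousOn (fun t ht => ?_) fun t ht => ?_
      · have htZ := (hball (hmem t (Set.Ioo_subset_Icc_self ht))).2 fun h => hx (h ▸ ht)
        have h := L.hasFDerivAt.comp_hasDerivAt t (hd t htZ)
        rw [map_smul, smul_eq_mul] at h
        exact h
      · exact (mul_pos (hρ t) (hball (hmem t (Set.Ioo_subset_Icc_self ht))).1).le
    refine (hint.mul_continuousOn_of_subset (g' := fun t => (L (T t))⁻¹)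
      (hLT.continuousOn.inv₀ fun t ht => (hball (hmem t ht)).1.ne') measurableSet_Ioc isCompact_Icc
      Set.Ioc_subset_Icc_self).congr_fun (fun t ht => ?_) measurableSet_Ioc
    exact mul_inv_cancel_right₀ (hball (hmem t (Set.Ioc_subset_Icc_self ht))).1.ne' _
  refine ⟨Set.Ioc (x - ε / 2) (x + ε / 2), Ioc_mem_nhds (by linarith) (by linarith), ?_⟩
  rw [← Set.Ioc_union_Ioc_eq_Ioc (by linarith : x - ε / 2 ≤ x) (by linarith : x ≤ x + ε / 2)]
  exact (hIoc _ _ (by linarith) (by linarith) (by simp)).union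
    (hIoc _ _ (by linarith) (by linarith) (by simp))

theorem countable_of_eventually_notMem {Z : Set ℝ} (hZ : ∀ x, ∀ᶠ t in 𝓝[≠] x, t ∉ Z) :
    Z.Countable := by
  refine (HereditarilyLindelofSpace.isLindelof Z).countable (discreteTopology_subtype_iff.2 ?_)
  intro x _
  rw [← disjoint_iff, disjoint_principal_right]
  exact hZ x

/-- A closed curve with continuous nonvanishing direction can be reparametrized to a regular
closed curve, even if its speed is singular at isolated times. -/
theorem isC1Curve_range_of_hasDerivAt_smul {F T : ℝ → Plane} {ρ : ℝ → ℝ} {Z : Set ℝ}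
    (hZ : ∀ x, ∀ᶠ t in 𝓝[≠] x, t ∉ Z) (hF : Continuous F) (hT : Continuous T)
    (hT0 : ∀ t, T t ≠ 0) (hρ : ∀ t, 0 < ρ t) (hρc : ∀ t ∉ Z, ContinuousAt ρ t)
    (hd : ∀ t ∉ Z, HasDerivAt F (ρ t • T t) t) (hFper : Function.Periodic F 1)
    (hρper : Function.Periodic ρ 1) (hinj : Set.InjOn F (Set.Ico 0 1)) :
    IsC1Curve (Set.range F) := by
  have hloc := locallyIntegrable_of_hasDerivAt_smul hZ hF hT hT0 hρ hd
  have hint : ∀ a b, IntervalIntegrable ρ volume a b := fun a b =>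
    (hloc.integrableOn_isCompact isCompact_uIcc).intervalIntegrable
  set S : ℝ → ℝ := fun t => ∫ x in (0 : ℝ)..t, ρ x with hS
  have hScont : Continuous S := intervalIntegral.continuous_primitive hint 0
  have hSmono : StrictMono S := by
    intro a b hab
    have h := intervalIntegral.intervalIntegral_pos_of_pos (hint a b) hρ hab
    rw [← intervalIntegral.integral_interval_sub_left (hint 0 b) (hint 0 a)] at h
    exact sub_pos.1 h
  have hSsurj : Function.Surjective S := hScont.surjective
    (hρper.tendsto_atTop_intervalIntegral_of_pos' (hint 0 1) hρ one_pos)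
    (hρper.tendsto_atBot_intervalIntegral_of_pos' (hint 0 1) hρ one_pos)
  have hS0 : S 0 = 0 := by simp [hS]
  have hSadd : ∀ t, S (t + 1) = S t + S 1 := fun t => by
    have h := hρper.intervalIntegral_add_eq t 0
    simp only [zero_add] at h
    simp only [hS, ← h]
    exact (intervalIntegral.integral_add_adjacent_intervals (hint _ _) (hint _ _)).symm
  have hSderiv : ∀ t ∉ Z, HasDerivAt S (ρ t) t := fun t ht =>
    intervalIntegral.integral_hasDerivAt_right (hint 0 t)
      hloc.aestronglyMeasurable.stronglyMeasurableAtFilter (hρc t ht)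
  set c := S 1 with hc
  have hcpos : 0 < c := hS0 ▸ hSmono one_pos
  let e : ℝ ≃o ℝ := hSmono.orderIsoOfSurjective S hSsurj
  have heS : ∀ t, e t = S t := fun _ => rfl
  set σ : ℝ → ℝ := fun s => e.symm (c * s) with hσ
  have hSσ : ∀ s, S (σ s) = c * s := fun s => e.apply_symm_apply (c * s)
  have hσcont : Continuous σ := e.symm.continuous.comp (continuous_const.mul continuous_id)
  have hσadd : ∀ s, σ (s + 1) = σ s + 1 := fun s => hSmono.injective <| by
    rw [hSadd, hSσ, hSσ, mul_add, mul_one]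
  have hσ0 : σ 0 = 0 := hSmono.injective <| by rw [hSσ, hS0, mul_zero]
  have hσmono : StrictMono σ := fun a b hab => hSmono.lt_iff_lt.1 <| by
    rw [hSσ, hSσ]
    exact mul_lt_mul_of_pos_left hab hcpos
  have hσsurj : Function.Surjective σ := fun t => ⟨S t / c, hSmono.injective <| by
    rw [hSσ, mul_div_cancel₀ _ hcpos.ne']⟩
  have hσ1 : σ 1 = 1 := by simpa [hσ0] using hσadd 0
  have hderiv : ∀ s, HasDerivAt (F ∘ σ) (c • T (σ s)) s := by
    refine hasDerivAt_of_continuous_of_countable (Z := σ ⁻¹' Z)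
      ((countable_of_eventually_notMem hZ).preimage hσmono.injective) (hF.comp hσcont)
      ((hT.comp hσcont).const_smul c) fun s hs => ?_
    have h1 : HasDerivAt σ (ρ (σ s) / c)⁻¹ s :=
      HasDerivAt.of_local_left_inverse (f := fun t => S t / c) hσcont.continuousAt
        ((hSderiv _ hs).div_const c) (div_pos (hρ _) hcpos).ne'
        (Eventually.of_forall fun y => by simp only [hSσ, mul_div_cancel_left₀ _ hcpos.ne'])
    convert (hd _ hs).scomp s h1 using 1
    rw [smul_smul, inv_div, div_mul_cancel₀ _ (hρ _).ne']
  refine ⟨F ∘ σ, ⟨?_, fun s => ?_, fun a ha b hb hab => ?_, fun s => ?_⟩, ?_⟩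
  · rw [contDiff_one_iff_deriv]
    refine ⟨fun s => (hderiv s).differentiableAt, ?_⟩
    rw [show deriv (F ∘ σ) = fun s => c • T (σ s) from funext fun s => (hderiv s).deriv]
    exact (hT.comp hσcont).const_smul c
  · simp only [Function.comp_apply, hσadd, hFper _]
  · have hmem : ∀ s ∈ Set.Ico (0 : ℝ) 1, σ s ∈ Set.Ico (0 : ℝ) 1 := fun s hs =>
      ⟨hσ0 ▸ hσmono.monotone hs.1, (hσmono hs.2).trans_eq hσ1⟩
    exact hσmono.injective (hinj (hmem a ha) (hmem b hb) hab)
  · rw [(hderiv s).deriv]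
    exact smul_ne_zero hcpos.ne' (hT0 _)
  · rw [Set.range_comp, hσsurj.range_eq, Set.image_univ]

end Reparametrization

section RadialPower

/-- The square of the Euclidean norm. -/
def euclSq (v : Plane) : ℝ := v.1 ^ 2 + v.2 ^ 2

/-- The Euclidean inner product. -/
def euclDot (v w : Plane) : ℝ := v.1 * w.1 + v.2 * w.2

/-- The radial map `v ↦ ‖v‖ ^ (2 * b) • v`. -/
def radialPow (b : ℝ) (v : Plane) : Plane := euclSq v ^ b • v

/-- The direction of the image under `radialPow b` of a velocity vector `y` based at `x`. -/
def radialDir (b : ℝ) (x y : Plane) : Plane := y + (2 * b * euclDot x y / euclSq x) • x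

theorem euclSq_nonneg (v : Plane) : 0 ≤ euclSq v := by unfold euclSq; positivity

theorem euclSq_pos {v : Plane} (hv : v ≠ 0) : 0 < euclSq v := by
  refine (euclSq_nonneg v).lt_of_ne fun h => hv ?_
  unfold euclSq at h
  ext <;> simp <;> nlinarith [sq_nonneg v.1, sq_nonneg v.2]

theorem continuous_euclSq : Continuous euclSq := by unfold euclSq; fun_prop

theorem euclSq_smul (k : ℝ) (v : Plane) : euclSq (k • v) = k ^ 2 * euclSq v := by
  simp only [euclSq, Prod.smul_fst, Prod.smul_snd, smul_eq_mul]
  ring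

theorem norm_le_rpow_euclSq (v : Plane) : ‖v‖ ≤ euclSq v ^ (1 / 2 : ℝ) := by
  rw [← Real.sqrt_eq_rpow, Prod.norm_def, max_le_iff, Real.norm_eq_abs, Real.norm_eq_abs]
  constructor <;> apply Real.abs_le_sqrt <;> unfold euclSq <;>
    nlinarith [sq_nonneg v.1, sq_nonneg v.2]

theorem radialPow_zero (b : ℝ) : radialPow b 0 = 0 := smul_zero _

theorem radialPow_radialPow {b c : ℝ} (h : 2 * c * b + b + c = 0) (v : Plane) :
    radialPow b (radialPow c v) = v := by
  rcases eq_or_ne v 0 with rfl | hv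
  · rw [radialPow_zero, radialPow_zero]
  have hN := euclSq_pos hv
  have h1 : (euclSq v ^ c) ^ 2 * euclSq v = euclSq v ^ (2 * c + 1) := by
    rw [Real.rpow_add hN, Real.rpow_one, mul_comm 2 c, Real.rpow_mul hN.le, Real.rpow_two]
  rw [radialPow, radialPow, euclSq_smul, h1, smul_smul, ← Real.rpow_mul hN.le, ← Real.rpow_add hN,
    show (2 * c + 1) * b + c = 0 by linarith, Real.rpow_zero, one_smul]

theorem continuous_radialPow {b : ℝ} (hb : 0 < b + 1 / 2) : Continuous (radialPow b) := by
  rw [continuous_iff_continuousAt]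
  intro v
  rcases eq_or_ne v 0 with rfl | hv
  · rw [ContinuousAt, radialPow_zero]
    have hbound : ∀ v, ‖radialPow b v‖ ≤ euclSq v ^ (b + 1 / 2) := fun v => by
      rcases eq_or_ne v 0 with rfl | hv
      · rw [radialPow_zero, norm_zero]
        exact Real.rpow_nonneg (euclSq_nonneg _) _
      · rw [radialPow, norm_smul, Real.norm_of_nonneg (Real.rpow_nonneg (euclSq_nonneg _) _),
          Real.rpow_add (euclSq_pos hv)]
        exact mul_le_mul_of_nonneg_left (norm_le_rpow_euclSq v)
          (Real.rpow_nonneg (euclSq_nonneg _) _)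
    refine squeeze_zero_norm hbound ?_
    have h := (continuous_euclSq.rpow_const fun _ => Or.inr hb.le).tendsto (0 : Plane)
    rwa [show euclSq 0 = 0 by simp [euclSq], Real.zero_rpow hb.ne'] at h
  · exact (continuous_euclSq.continuousAt.rpow_const (Or.inl (euclSq_pos hv).ne')).smul
      continuousAt_id

theorem radialDir_smul (b : ℝ) {k : ℝ} (hk : k ≠ 0) (x y : Plane) :
    radialDir b (k • x) y = radialDir b x y := by
  have h1 : euclDot (k • x) y = k * euclDot x y := by
    simp only [euclDot, Prod.smul_fst, Prod.smul_snd, smul_eq_mul]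
    ring
  rw [radialDir, radialDir, euclSq_smul, h1, smul_smul]
  congr 2
  rcases eq_or_ne (euclSq x) 0 with h | h
  · simp [h]
  · field_simp

theorem radialDir_ne_zero {b : ℝ} (hb : 0 < b + 1 / 2) {x y : Plane} (hx : x ≠ 0) (hy : y ≠ 0) :
    radialDir b x y ≠ 0 := by
  intro h
  have hN := euclSq_pos hx
  have hdot : euclDot x (radialDir b x y) = (1 + 2 * b) * euclDot x y := by
    have : euclDot x (radialDir b x y) =
        euclDot x y + 2 * b * euclDot x y / euclSq x * euclSq x := by
      simp only [radialDir, euclDot, euclSq, Prod.fst_add, Prod.snd_add, Prod.smul_fst,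
        Prod.smul_snd, smul_eq_mul]
      ring
    rw [this, div_mul_cancel₀ _ hN.ne']
    ring
  rw [h, show euclDot x 0 = 0 by simp [euclDot], eq_comm, mul_eq_zero] at hdot
  have h0 : euclDot x y = 0 := hdot.resolve_left (by linarith)
  exact hy (by simpa [radialDir, h0] using h)

theorem continuousAt_radialDir (b : ℝ) {f g : ℝ → Plane} {t : ℝ} (hf : ContinuousAt f t)
    (hg : ContinuousAt g t) (h0 : f t ≠ 0) : ContinuousAt (fun s => radialDir b (f s) (g s)) t := by
  have hN : ContinuousAt (fun s => euclSq (f s)) t := continuous_euclSq.continuousAt.comp hf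
  have hD : ContinuousAt (fun s => 2 * b * euclDot (f s) (g s)) t := by
    unfold euclDot
    fun_prop
  exact hg.add ((hD.div hN (euclSq_pos h0).ne').smul hf)

theorem HasDerivAt.radialPow {b : ℝ} {γ : ℝ → Plane} {γ' : Plane} {t : ℝ}
    (hγ : HasDerivAt γ γ' t) (h0 : γ t ≠ 0) :
    HasDerivAt (fun s => radialPow b (γ s)) (euclSq (γ t) ^ b • radialDir b (γ t) γ') t := by
  have hN := euclSq_pos h0
  have h1 : HasDerivAt (fun s => (γ s).1) γ'.1 t :=
    (ContinuousLinearMap.fst ℝ ℝ ℝ).hasFDerivAt.comp_hasDerivAt t hγ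
  have h2 : HasDerivAt (fun s => (γ s).2) γ'.2 t :=
    (ContinuousLinearMap.snd ℝ ℝ ℝ).hasFDerivAt.comp_hasDerivAt t hγ
  have hsq : HasDerivAt (fun s => euclSq (γ s)) (2 * euclDot (γ t) γ') t := by
    refine ((h1.fun_pow 2).fun_add (h2.fun_pow 2)).congr_deriv ?_
    simp only [euclDot]
    push_cast
    ring
  refine ((hsq.rpow_const (p := b) (Or.inl hN.ne')).fun_smul hγ).congr_deriv ?_
  rw [radialDir, smul_add, smul_smul, Real.rpow_sub_one hN.ne']
  congr 2
  ring

theorem mapsC1_radialPow {b : ℝ} (hb : 0 < b + 1 / 2) (hinj : Function.Injective (radialPow b)) :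
    MapsC1 (radialPow b) := by
  classical
  rintro _ ⟨γ, ⟨hγ, hper, hγinj, hreg⟩, rfl⟩
  obtain ⟨hdiff, hcont'⟩ := contDiff_one_iff_deriv.1 hγ
  rw [← Set.range_comp]
  refine isC1Curve_range_of_hasDerivAt_smul (Z := {t | γ t = 0})
    (T := fun t => radialDir b (if γ t = 0 then deriv γ t else γ t) (deriv γ t))
    (ρ := fun t => if γ t = 0 then 1 else euclSq (γ t) ^ b)
    (fun x => (hdiff x).hasDerivAt.eventually_ne (hreg x))
    ((continuous_radialPow hb).comp hγ.continuous) ?_ (fun t => ?_) (fun t => ?_)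
    (fun t ht => ?_) (fun t ht => ?_) (fun t => ?_) (fun t => ?_) (hinj.comp_injOn hγinj)
  · rw [continuous_iff_continuousAt]
    intro t
    by_cases h0 : γ t = 0
    · refine (continuousAt_radialDir b (continuousAt_dslope_same.2 (hdiff t)) hcont'.continuousAt
        (by rw [dslope_same]; exact hreg t)).congr ?_
      filter_upwards [eventually_nhdsWithin_iff.1 ((hdiff t).hasDerivAt.eventually_ne (hreg t))]
        with s hs
      rcases eq_or_ne s t with rfl | hst
      · rw [dslope_same, if_pos h0]
      · rw [dslope_of_ne _ hst, slope_def_module, h0, sub_zero, if_neg (hs hst),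
          radialDir_smul _ (inv_ne_zero (sub_ne_zero.2 hst))]
    · refine (continuousAt_radialDir b hγ.continuous.continuousAt hcont'.continuousAt h0).congr ?_
      filter_upwards [hγ.continuous.continuousAt.eventually_ne h0] with s hs
      rw [if_neg hs]
  · refine radialDir_ne_zero hb ?_ (hreg t)
    split_ifs with h
    exacts [hreg t, h]
  · split_ifs with h
    exacts [one_pos, Real.rpow_pos_of_pos (euclSq_pos h) b]
  · refine ((continuous_euclSq.comp hγ.continuous).continuousAt.rpow_const (p := b)
      (Or.inl (euclSq_pos ht).ne')).congr ?_
    filter_upwards [hγ.continuous.continuousAt.eventually_ne ht] with s hs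
    rw [if_neg hs, Function.comp_apply]
  · have h0 : γ t ≠ 0 := ht
    rw [if_neg h0, if_neg h0]
    exact (hdiff t).hasDerivAt.radialPow h0
  · simp only [Function.comp_apply, hper t]
  · simp only [hper t]

/-- The radial power maps with exponents `b` and `c` form a homeomorphism when inverse. -/
def radialHomeo {b c : ℝ} (hb : 0 < b + 1 / 2) (hc : 0 < c + 1 / 2)
    (h : 2 * c * b + b + c = 0) : Plane ≃ₜ Plane where
  toFun := radialPow b
  invFun := radialPow c
  left_inv := radialPow_radialPow (by linarith)
  right_inv := radialPow_radialPow h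
  continuous_toFun := continuous_radialPow hb
  continuous_invFun := continuous_radialPow hc

end RadialPower

/-- The map `H(v) = ‖v‖ • v` (Euclidean norm) is a homeomorphism lying in
`Homeo¹(ℝ²)`, is differentiable at the origin with derivative the zero map, and its
inverse is not differentiable at the origin; hence `H` is not a C¹ diffeomorphism. -/
theorem squaring_map_in_homeo1 :
    ∃ h : Plane ≃ₜ Plane,
      (∀ v : Plane, h v = Real.sqrt (v.1 ^ 2 + v.2 ^ 2) • v) ∧
      Function.Bijective (fun v : Plane => Real.sqrt (v.1 ^ 2 + v.2 ^ 2) • v) ∧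
      InHomeo1 h ∧
      HasFDerivAt (⇑h) (0 : Plane →L[ℝ] Plane) 0 ∧
      ¬ DifferentiableAt ℝ (⇑h.symm) 0 := by
  have hb : (0 : ℝ) < 1 / 2 + 1 / 2 := by norm_num
  have hc : (0 : ℝ) < -(1 / 4) + 1 / 2 := by norm_num
  let h : Plane ≃ₜ Plane := radialHomeo hb hc (by norm_num)
  have hval : ∀ v : Plane, h v = Real.sqrt (v.1 ^ 2 + v.2 ^ 2) • v := fun v => by
    rw [Real.sqrt_eq_rpow]
    rfl
  have hfun : (h : Plane → Plane) = fun v => Real.sqrt (v.1 ^ 2 + v.2 ^ 2) • v := funext hval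
  have h0 : h 0 = 0 := radialPow_zero _
  have hderiv : HasFDerivAt (⇑h) (0 : Plane →L[ℝ] Plane) 0 := by
    rw [hasFDerivAt_iff_isLittleO_nhds_zero]
    have hlim : Tendsto (fun v : Plane => Real.sqrt (v.1 ^ 2 + v.2 ^ 2)) (𝓝 0) (𝓝 0) := by
      have hcont : Continuous fun v : Plane => Real.sqrt (v.1 ^ 2 + v.2 ^ 2) := by fun_prop
      simpa using hcont.tendsto 0
    have hsmul := ((Asymptotics.isLittleO_one_iff ℝ).2 hlim).smul_isBigO
      (Asymptotics.isBigO_refl (fun v : Plane => v) (𝓝 0))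
    simpa [h0, hval] using hsmul
  refine ⟨h, hval, hfun ▸ h.bijective,
    ⟨mapsC1_radialPow hb h.injective, mapsC1_radialPow hc h.symm.injective⟩, hderiv, fun hd => ?_⟩
  rw [← h0] at hd
  have hcomp := hd.hasFDerivAt.comp (0 : Plane) hderiv
  rw [ContinuousLinearMap.comp_zero, show ⇑h.symm ∘ ⇑h = id from funext h.symm_apply_apply] at hcomp
  have heq := congrArg (fun L : Plane →L[ℝ] Plane => (L (1, 0)).1)
    (hcomp.unique (hasFDerivAt_id (0 : Plane)))
  simp at heq
end
end

section
/- There exist an element f ∈ Homeo¹(ℝ²) and, for each q ∈ ℝ², a homeomorphism φ_q : ℙ(ℝ²) → ℙ(ℝ²) induced by f at q, such that the map ℝ² × ℙ(ℝ²) → ℝ² × ℙ(ℝ²) given by (q, ℓ) ↦ (f(q), φ_q(ℓ)) is not continuous. -/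
open Filter Topology

noncomputable section

/-- The vertical perturbation `x⁴y / (2(x⁴ + y²))`, extended by `0` at the origin. -/
def bump (p : Plane) : ℝ := p.1 ^ 4 * p.2 / (2 * (p.1 ^ 4 + p.2 ^ 2))

/-- The partial derivative of `bump` in the first coordinate. -/
def bumpX (p : Plane) : ℝ := 2 * p.1 ^ 3 * p.2 ^ 3 / (p.1 ^ 4 + p.2 ^ 2) ^ 2

/-- The partial derivative of `bump` in the second coordinate. -/
def bumpY (p : Plane) : ℝ :=
  p.1 ^ 4 * (p.1 ^ 4 - p.2 ^ 2) / (2 * (p.1 ^ 4 + p.2 ^ 2) ^ 2)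

lemma denom_pos {p : Plane} (hp : p ≠ 0) : 0 < p.1 ^ 4 + p.2 ^ 2 := by
  rcases eq_or_ne p.1 0 with h | h
  · have h2 : p.2 ≠ 0 := fun h2 => hp (Prod.ext h h2)
    positivity
  · positivity

lemma abs_bump_le (p : Plane) : |bump p| ≤ p.1 ^ 2 / 4 := by
  rcases eq_or_ne p 0 with rfl | hp
  · simp [bump]
  have hD := denom_pos hp
  rw [bump, abs_div, abs_of_pos (by positivity : 0 < 2 * (p.1 ^ 4 + p.2 ^ 2)),
    div_le_iff₀ (by positivity), abs_le]
  constructor <;>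
    nlinarith [mul_nonneg (sq_nonneg p.1) (sq_nonneg (p.1 ^ 2 - p.2)),
      mul_nonneg (sq_nonneg p.1) (sq_nonneg (p.1 ^ 2 + p.2))]

lemma abs_bumpX_le (p : Plane) : |bumpX p| ≤ |p.1| := by
  rcases eq_or_ne p 0 with rfl | hp
  · simp [bumpX]
  have hD := denom_pos hp
  rw [bumpX, abs_div, abs_of_pos (by positivity : 0 < (p.1 ^ 4 + p.2 ^ 2) ^ 2),
    div_le_iff₀ (by positivity)]
  have h1 : |2 * p.1 ^ 3 * p.2 ^ 3| = |p.1| * ((2 * (p.1 ^ 2 * |p.2|)) * p.2 ^ 2) := by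
    rw [abs_mul, abs_mul, abs_pow, abs_pow, ← sq_abs p.1, ← sq_abs p.2, abs_two]
    ring
  rw [h1]
  have h2 : 2 * (p.1 ^ 2 * |p.2|) ≤ p.1 ^ 4 + p.2 ^ 2 := by
    nlinarith [sq_nonneg (p.1 ^ 2 - |p.2|), sq_abs p.2]
  have h3 : p.2 ^ 2 ≤ p.1 ^ 4 + p.2 ^ 2 := by
    have : 0 ≤ p.1 ^ 4 := by positivity
    linarith
  rw [sq (p.1 ^ 4 + p.2 ^ 2)]
  gcongr

lemma abs_bumpY_le (p : Plane) : |bumpY p| ≤ 1 / 2 := by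
  rcases eq_or_ne p 0 with rfl | hp
  · simp [bumpY]
  have hD := denom_pos hp
  have hx : 0 ≤ p.1 ^ 4 := by positivity
  have hy : 0 ≤ p.2 ^ 2 := by positivity
  rw [bumpY, abs_div, abs_of_pos (by positivity : 0 < 2 * (p.1 ^ 4 + p.2 ^ 2) ^ 2),
    div_le_iff₀ (by positivity), abs_le]
  constructor <;> nlinarith [mul_nonneg hx hy, mul_nonneg hx hx, mul_nonneg hy hy]

lemma abs_bumpY_mul_le (p : Plane) : |bumpY p| * p.2 ^ 2 ≤ p.1 ^ 4 := by
  rcases eq_or_ne p 0 with rfl | hp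
  · simp [bumpY]
  have hD := denom_pos hp
  have hx : 0 ≤ p.1 ^ 4 := by positivity
  have hy : 0 ≤ p.2 ^ 2 := by positivity
  rw [bumpY, abs_div, abs_of_pos (by positivity : 0 < 2 * (p.1 ^ 4 + p.2 ^ 2) ^ 2),
    div_mul_eq_mul_div, div_le_iff₀ (by positivity), abs_mul, abs_of_nonneg hx, mul_assoc]
  refine mul_le_mul_of_nonneg_left ?_ hx
  have h : |p.1 ^ 4 - p.2 ^ 2| ≤ p.1 ^ 4 + p.2 ^ 2 := by
    rw [abs_le]; constructor <;> linarith
  calc |p.1 ^ 4 - p.2 ^ 2| * p.2 ^ 2 ≤ (p.1 ^ 4 + p.2 ^ 2) * (p.1 ^ 4 + p.2 ^ 2) := by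
        gcongr; linarith
    _ ≤ 2 * (p.1 ^ 4 + p.2 ^ 2) ^ 2 := by nlinarith

lemma abs_bump_sub_le (x y z : ℝ) : |bump (x, y) - bump (x, z)| ≤ |y - z| / 2 := by
  rcases eq_or_ne x 0 with rfl | hx
  · simp only [bump]
    norm_num
    positivity
  have hy : 0 < x ^ 4 + y ^ 2 := by positivity
  have hz : 0 < x ^ 4 + z ^ 2 := by positivity
  have h : bump (x, y) - bump (x, z) =
      (x ^ 4 * (x ^ 4 - y * z)) / ((x ^ 4 + y ^ 2) * (x ^ 4 + z ^ 2)) * ((y - z) / 2) := by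
    simp only [bump]
    field_simp
    ring
  rw [h, abs_mul, abs_div (y - z), abs_two]
  refine mul_le_of_le_one_left (by positivity) ?_
  rw [abs_div, abs_of_pos (mul_pos hy hz), div_le_one (mul_pos hy hz), abs_le]
  have hx4 : 0 ≤ x ^ 4 := by positivity
  constructor <;>
    nlinarith [mul_nonneg hx4 (sq_nonneg (y - z)), mul_nonneg hx4 (sq_nonneg (y + z)),
      mul_nonneg hx4 (sq_nonneg y), mul_nonneg hx4 (sq_nonneg z), mul_nonneg hx4 hx4,
      sq_nonneg (y * z)]

lemma one_add_bumpY_pos (p : Plane) : 0 < 1 + bumpY p := by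
  have := (abs_le.1 (abs_bumpY_le p)).1
  linarith

lemma continuous_bumpX : Continuous bumpX := by
  rw [continuous_iff_continuousAt]
  intro p
  rcases eq_or_ne p 0 with rfl | hp
  · have h0 : bumpX 0 = 0 := by simp [bumpX]
    rw [ContinuousAt, h0]
    refine squeeze_zero_norm (a := fun p : Plane => |p.1|) abs_bumpX_le ?_
    have : Continuous fun p : Plane => |p.1| := by fun_prop
    simpa using this.tendsto 0
  · have := (denom_pos hp).ne'
    unfold bumpX
    fun_prop (disch := positivity)

lemma continuousAt_bumpY {p : Plane} (hp : p ≠ 0) : ContinuousAt bumpY p := by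
  have := (denom_pos hp).ne'
  unfold bumpY
  fun_prop (disch := positivity)

lemma hasFDerivAt_bump (p : Plane) :
    HasFDerivAt bump (bumpX p • ContinuousLinearMap.fst ℝ ℝ ℝ +
      bumpY p • ContinuousLinearMap.snd ℝ ℝ ℝ) p := by
  rcases eq_or_ne p 0 with rfl | hp
  · have h : HasFDerivAt bump (0 : Plane →L[ℝ] ℝ) 0 := by
      refine Asymptotics.IsBigO.hasFDerivAt (n := 2) ?_ one_lt_two
      refine Asymptotics.IsBigO.of_bound 1 (Eventually.of_forall fun p => ?_)
      have h1 := abs_bump_le p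
      have h2 : |p.1| ≤ ‖p‖ := norm_fst_le p
      have h3 : p.1 ^ 2 ≤ ‖p‖ ^ 2 := by
        rw [← sq_abs]; gcongr
      simp only [sub_zero, one_mul, Real.norm_eq_abs, norm_pow, abs_norm]
      nlinarith [sq_nonneg p.1]
    simpa [bumpX, bumpY] using h
  · have hD := denom_pos hp
    have hx : HasFDerivAt (fun p : Plane => p.1) (ContinuousLinearMap.fst ℝ ℝ ℝ) p :=
      hasFDerivAt_fst
    have hy : HasFDerivAt (fun p : Plane => p.2) (ContinuousLinearMap.snd ℝ ℝ ℝ) p :=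
      hasFDerivAt_snd
    have hD2 : 2 * (p.1 ^ 4 + p.2 ^ 2) ≠ 0 := by positivity
    have h := ((hx.pow 4).mul hy).mul ((hasDerivAt_inv hD2).comp_hasFDerivAt p
      (((hx.pow 4).add (hy.pow 2)).const_mul 2))
    refine HasFDerivAt.congr_fderiv (f := bump) h ?_
    ext
    all_goals
      simp [bumpX, bumpY]
      field_simp
      ring

/-- The shear `(x, y) ↦ (x, y + bump (x, y))`. -/
def shear (p : Plane) : Plane := (p.1, p.2 + bump p)

/-- The differential of `shear` at `p`. -/
def shearDeriv (p : Plane) : Plane ≃L[ℝ] Plane :=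
  ContinuousLinearEquiv.equivOfInverse
    ((ContinuousLinearMap.fst ℝ ℝ ℝ).prod
      (bumpX p • ContinuousLinearMap.fst ℝ ℝ ℝ +
        (1 + bumpY p) • ContinuousLinearMap.snd ℝ ℝ ℝ))
    ((ContinuousLinearMap.fst ℝ ℝ ℝ).prod
      ((1 + bumpY p)⁻¹ • (ContinuousLinearMap.snd ℝ ℝ ℝ -
        bumpX p • ContinuousLinearMap.fst ℝ ℝ ℝ)))
    (fun v => by
      have := (one_add_bumpY_pos p).ne'
      ext
      · simp
      · simp
        field_simp)
    (fun v => by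
      have := (one_add_bumpY_pos p).ne'
      ext
      · simp
      · simp
        field_simp
        ring)

lemma shearDeriv_apply (p v : Plane) :
    shearDeriv p v = (v.1, bumpX p * v.1 + (1 + bumpY p) * v.2) := by
  simp [shearDeriv]

lemma shearDeriv_symm_apply (p v : Plane) :
    (shearDeriv p).symm v = (v.1, (1 + bumpY p)⁻¹ * (v.2 - bumpX p * v.1)) := by
  simp [shearDeriv]

lemma shearDeriv_zero_symm_apply (v : Plane) : (shearDeriv 0).symm v = v := by
  simp [shearDeriv_symm_apply, bumpX, bumpY]

lemma hasFDerivAt_shear (p : Plane) :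
    HasFDerivAt shear (shearDeriv p : Plane →L[ℝ] Plane) p := by
  have h : HasFDerivAt shear _ p :=
    hasFDerivAt_fst.prodMk (hasFDerivAt_snd.add (hasFDerivAt_bump p))
  refine h.congr_fderiv ?_
  ext <;> simp [shearDeriv_apply]

lemma continuous_shear : Continuous shear :=
  continuous_iff_continuousAt.2 fun p => (hasFDerivAt_shear p).continuousAt

lemma abs_sub_le_shear (x y z : ℝ) :
    |y - z| ≤ 2 * |(shear (x, y)).2 - (shear (x, z)).2| := by
  have h1 := abs_bump_sub_le x y z
  have h2 : |y - z| ≤ |(shear (x, y)).2 - (shear (x, z)).2| + |bump (x, y) - bump (x, z)| := by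
    have h3 : y - z = ((shear (x, y)).2 - (shear (x, z)).2) - (bump (x, y) - bump (x, z)) := by
      simp only [shear]
      ring
    conv_lhs => rw [h3]
    exact abs_sub _ _
  linarith

lemma shear_injective : Function.Injective shear := by
  rintro ⟨x, y⟩ ⟨x', z⟩ h
  obtain rfl : x = x' := congrArg Prod.fst h
  have h1 := abs_sub_le_shear x y z
  rw [h, sub_self, abs_zero, mul_zero] at h1
  rw [sub_eq_zero.1 (abs_nonpos_iff.1 h1)]

lemma shear_surjective : Function.Surjective shear := by
  rintro ⟨x, w⟩
  have hc : Continuous fun y : ℝ => (shear (x, y)).2 :=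
    continuous_snd.comp (continuous_shear.comp (by fun_prop))
  have hb : ∀ y, |bump (x, y)| ≤ x ^ 2 / 4 := fun y => abs_bump_le (x, y)
  obtain ⟨y, hy⟩ := hc.surjective
    (tendsto_atTop_mono (f := fun y => y + -(x ^ 2 / 4))
      (fun y => by simpa [shear] using (abs_le.1 (hb y)).1)
      (tendsto_atTop_add_const_right _ _ tendsto_id))
    (tendsto_atBot_mono (f := fun y => y + x ^ 2 / 4)
      (fun y => by simpa [shear] using (abs_le.1 (hb y)).2)
      (tendsto_atBot_add_const_right _ _ tendsto_id)) w
  exact ⟨(x, y), Prod.ext rfl hy⟩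

/-- `shear` as a bijection of the plane. -/
def shearEquiv : Plane ≃ Plane := Equiv.ofBijective shear ⟨shear_injective, shear_surjective⟩

lemma continuous_shearEquiv_symm : Continuous shearEquiv.symm := by
  have hs : ∀ q, shear (shearEquiv.symm q) = q := shearEquiv.apply_symm_apply
  have hfst : ∀ q, (shearEquiv.symm q).1 = q.1 := fun q => (congrArg Prod.fst (hs q) :)
  rw [continuous_iff_continuousAt]
  intro q₀
  have h2 : ContinuousAt (fun q => (shearEquiv.symm q).2) q₀ := by
    set y₀ := (shearEquiv.symm q₀).2 with hy₀
    have hc : Continuous fun q : Plane => 2 * |q.2 - (shear (q.1, y₀)).2| := by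
      have h : Continuous fun q : Plane => (shear (q.1, y₀)).2 :=
        continuous_snd.comp (continuous_shear.comp (by fun_prop))
      exact continuous_const.mul (continuous_snd.sub h).abs
    have hq₀ : shear (q₀.1, y₀) = q₀ := by
      rw [← hfst q₀, hy₀]
      exact hs q₀
    rw [ContinuousAt, tendsto_iff_dist_tendsto_zero]
    refine squeeze_zero (fun _ => dist_nonneg) (fun q => ?_)
      (by simpa [hq₀] using hc.tendsto q₀)
    have h := abs_sub_le_shear q.1 (shearEquiv.symm q).2 y₀
    have hq : shear (q.1, (shearEquiv.symm q).2) = q := by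
      rw [← hfst q]
      exact hs q
    rwa [hq] at h
  have h : ContinuousAt (fun q : Plane => (q.1, (shearEquiv.symm q).2)) q₀ :=
    continuousAt_fst.prodMk h2
  exact h.congr (Eventually.of_forall fun q => Prod.ext (hfst q).symm rfl)

/-- `shear` as a homeomorphism of the plane. -/
def shearHomeo : Plane ≃ₜ Plane where
  toEquiv := shearEquiv
  continuous_toFun := continuous_shear
  continuous_invFun := continuous_shearEquiv_symm

lemma hasFDerivAt_shearHomeo_symm (q : Plane) :
    HasFDerivAt shearHomeo.symm ((shearDeriv (shearHomeo.symm q)).symm : Plane →L[ℝ] Plane) q :=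
  (hasFDerivAt_shear (shearHomeo.symm q)).of_local_left_inverse
    shearHomeo.symm.continuous.continuousAt
    (Eventually.of_forall shearHomeo.apply_symm_apply)

lemma tendsto_bumpY_comp {γ : ℝ → Plane} {t : ℝ} {v : Plane} (hγ : HasDerivAt γ v t)
    (h0 : γ t = 0) (hv : v.2 ≠ 0) : Tendsto (fun s => bumpY (γ s)) (𝓝 t) (𝓝 0) := by
  have hb0 : bumpY (γ t) = 0 := by simp [h0, bumpY]
  suffices h : Tendsto (fun s => bumpY (γ s)) (𝓝[≠] t) (𝓝 0) by
    have hc : ContinuousAt (fun s => bumpY (γ s)) t := by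
      rw [continuousAt_iff_punctured_nhds, hb0]
      exact h
    simpa [ContinuousAt, hb0] using hc
  have hs := hasDerivAt_iff_tendsto_slope.1 hγ
  have hs1 := (continuous_fst.tendsto v).comp hs
  have hs2 := (continuous_snd.tendsto v).comp hs
  have hγ1 : Tendsto (fun s => (γ s).1) (𝓝[≠] t) (𝓝 0) := by
    have := ((continuous_fst.tendsto _).comp hγ.continuousAt.tendsto).mono_left
      (nhdsWithin_le_nhds (s := {t}ᶜ))
    simpa [h0, Function.comp_def] using this
  have hlim := ((hs1.pow 2).div (hs2.pow 2) (pow_ne_zero 2 hv)).mul (hγ1.pow 2)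
  rw [zero_pow two_ne_zero, mul_zero] at hlim
  refine squeeze_zero_norm' ?_ hlim
  filter_upwards [hs2.eventually_ne hv, self_mem_nhdsWithin] with s hs hst
  have hst' : s - t ≠ 0 := sub_ne_zero.2 hst
  have hy : (γ s).2 ≠ 0 := by
    intro hy
    apply hs
    simp [slope, h0, hy]
  have hb := abs_bumpY_mul_le (γ s)
  rw [← le_div_iff₀ (by positivity)] at hb
  refine hb.trans (le_of_eq ?_)
  simp [slope, h0]
  field_simp

lemma continuous_bumpY_comp_mul {γ γ' : ℝ → Plane} {β : Plane → ℝ} {C : ℝ} {w : ℝ → ℝ}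
    (hγ : ∀ t, HasDerivAt γ (γ' t) t) (hβ : ∀ p ≠ 0, ContinuousAt β p)
    (hβY : ∀ p, |β p| ≤ C * |bumpY p|) (hC : 0 ≤ C) (hw : Continuous w)
    (hw0 : ∀ t, γ t = 0 → (γ' t).2 = 0 → w t = 0) :
    Continuous fun t => β (γ t) * w t := by
  rw [continuous_iff_continuousAt]
  intro t
  by_cases h0 : γ t = 0
  · have hb0 : β (γ t) = 0 := by
      have := hβY (γ t)
      simpa [h0, bumpY] using this
    rw [ContinuousAt, hb0, zero_mul]
    by_cases hv : (γ' t).2 = 0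
    · refine squeeze_zero_norm (a := fun s => C * (1 / 2) * |w s|) (fun s => ?_) ?_
      · rw [norm_mul, Real.norm_eq_abs, Real.norm_eq_abs]
        gcongr
        exact (hβY _).trans (by gcongr; exact abs_bumpY_le _)
      · have : Continuous fun s => C * (1 / 2) * |w s| := by fun_prop
        simpa [hw0 t h0 hv] using this.tendsto t
    · have h1 := tendsto_bumpY_comp (hγ t) h0 hv
      have h2 : Tendsto (fun s => β (γ s)) (𝓝 t) (𝓝 0) :=
        squeeze_zero_norm (fun s => hβY (γ s)) (by simpa using h1.abs.const_mul C)
      simpa using h2.mul (hw.tendsto t)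
  · exact ((hβ _ h0).comp (hγ t).continuousAt).mul hw.continuousAt

lemma IsRegParam.of_hasDerivAt {f : Plane → Plane} (hf : Function.Injective f)
    {γ δ' : ℝ → Plane} (h : IsRegParam γ) (hd : ∀ t, HasDerivAt (f ∘ γ) (δ' t) t)
    (hc : Continuous δ') (hn : ∀ t, δ' t ≠ 0) : IsRegParam (f ∘ γ) := by
  have hderiv : deriv (f ∘ γ) = δ' := funext fun t => (hd t).deriv
  refine ⟨contDiff_one_iff_deriv.2 ⟨fun t => (hd t).differentiableAt, hderiv ▸ hc⟩,
    fun t => congrArg f (h.2.1 t), hf.comp_injOn h.2.2.1, fun t => hderiv ▸ hn t⟩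

lemma IsRegParam.hasDerivAt {γ : ℝ → Plane} (h : IsRegParam γ) (t : ℝ) :
    HasDerivAt γ (deriv γ t) t :=
  (h.1.differentiable one_ne_zero t).hasDerivAt

lemma IsRegParam.hasDerivAt_shear_comp {γ : ℝ → Plane} (h : IsRegParam γ) (t : ℝ) :
    HasDerivAt (shear ∘ γ) (shearDeriv (γ t) (deriv γ t)) t :=
  (hasFDerivAt_shear (γ t)).comp_hasDerivAt t (h.hasDerivAt t)

lemma IsRegParam.shear_comp {γ : ℝ → Plane} (h : IsRegParam γ) : IsRegParam (shear ∘ γ) := by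
  refine h.of_hasDerivAt shear_injective h.hasDerivAt_shear_comp ?_
    fun t => (shearDeriv (γ t)).map_ne_zero_iff.2 (h.2.2.2 t)
  have hγ' : Continuous (deriv γ) := h.1.continuous_deriv le_rfl
  have hγ := h.1.continuous
  have hb := continuous_bumpY_comp_mul (C := 1) (w := fun t => (deriv γ t).2) h.hasDerivAt
    (fun p => continuousAt_bumpY) (fun p => by simp) zero_le_one (by fun_prop)
    (fun t _ ht => ht)
  have ha := continuous_bumpX.comp hγ
  simp only [shearDeriv_apply, add_mul, one_mul]
  simp only [Function.comp_def] at ha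
  fun_prop

lemma IsRegParam.shear_symm_comp {γ : ℝ → Plane} (h : IsRegParam γ) :
    IsRegParam (shearHomeo.symm ∘ γ) := by
  have hd : ∀ t, HasDerivAt (shearHomeo.symm ∘ γ)
      ((shearDeriv (shearHomeo.symm (γ t))).symm (deriv γ t)) t := fun t =>
    (hasFDerivAt_shearHomeo_symm (γ t)).comp_hasDerivAt t (h.hasDerivAt t)
  refine h.of_hasDerivAt shearHomeo.symm.injective hd ?_
    fun t => (shearDeriv _).symm.map_ne_zero_iff.2 (h.2.2.2 t)
  have hγ' : Continuous (deriv γ) := h.1.continuous_deriv le_rfl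
  have hγ : Continuous (fun t => shearHomeo.symm (γ t)) :=
    shearHomeo.symm.continuous.comp h.1.continuous
  have ha := continuous_bumpX.comp hγ
  simp only [Function.comp_def] at ha
  have hinv : ∀ p, (1 + bumpY p)⁻¹ = 1 + -(bumpY p / (1 + bumpY p)) := fun p => by
    have := (one_add_bumpY_pos p).ne'
    field_simp
    ring
  have hb := continuous_bumpY_comp_mul (C := 2) (β := fun p => -(bumpY p / (1 + bumpY p)))
    (w := fun t => (deriv γ t).2 - bumpX (shearHomeo.symm (γ t)) * (deriv γ t).1) hd
    (fun p hp => ((continuousAt_bumpY hp).div (continuousAt_const.add (continuousAt_bumpY hp))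
      (one_add_bumpY_pos p).ne').neg)
    (fun p => by
      have h1 := one_add_bumpY_pos p
      have h2 := (abs_le.1 (abs_bumpY_le p)).1
      rw [abs_neg, abs_div, abs_of_pos h1, div_le_iff₀ h1]
      nlinarith [abs_nonneg (bumpY p)])
    zero_le_two (by fun_prop)
    (fun t h0 ht => by
      have h0' : shearHomeo.symm (γ t) = 0 := h0
      rw [h0', shearDeriv_zero_symm_apply] at ht
      rw [h0', ht]
      simp [bumpX])
  simp only [shearDeriv_symm_apply, hinv, add_mul, one_mul]
  simp only [Function.comp_def] at hb
  fun_prop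

lemma mapsC1_of_isRegParam_comp {f : Plane → Plane}
    (hf : ∀ γ, IsRegParam γ → IsRegParam (f ∘ γ)) : MapsC1 f := by
  rintro _ ⟨γ, hγ, rfl⟩
  exact ⟨f ∘ γ, hf γ hγ, (Set.range_comp f γ).symm⟩

lemma inHomeo1_shearHomeo : InHomeo1 shearHomeo :=
  ⟨mapsC1_of_isRegParam_comp fun _ h => h.shear_comp,
    mapsC1_of_isRegParam_comp fun _ h => h.shear_symm_comp⟩

lemma continuous_projectivization_map (e : Plane ≃L[ℝ] Plane) :
    Continuous (Projectivization.map (e : Plane →ₗ[ℝ] Plane) e.injective) := by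
  refine Continuous.quotient_map' ?_ _
  exact Continuous.subtype_mk (e.continuous.comp continuous_subtype_val) _

/-- The homeomorphism of the projective line induced by a linear automorphism of the plane. -/
def projHomeo (e : Plane ≃L[ℝ] Plane) : ProjLine ≃ₜ ProjLine where
  toFun := Projectivization.map (e : Plane →ₗ[ℝ] Plane) e.injective
  invFun := Projectivization.map (e.symm : Plane →ₗ[ℝ] Plane) e.symm.injective
  left_inv ℓ := by
    induction ℓ using Projectivization.ind with
    | h v hv => simp [Projectivization.map_mk]
  right_inv ℓ := by
    induction ℓ using Projectivization.ind with
    | h v hv => simp [Projectivization.map_mk]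
  continuous_toFun := continuous_projectivization_map e
  continuous_invFun := continuous_projectivization_map e.symm

lemma projHomeo_mk (e : Plane ≃L[ℝ] Plane) (v : Plane) (hv : v ≠ 0) :
    projHomeo e (Projectivization.mk ℝ v hv) =
      Projectivization.mk ℝ (e v) (e.map_ne_zero_iff.2 hv) := rfl

lemma inducesAt_shear (q : Plane) : InducesAt shear q (projHomeo (shearDeriv q)) := by
  rintro _ _ ⟨γ, t, h, rfl, rfl, rfl⟩
  refine ⟨⟨_, h.shear_comp, (Set.range_comp shear γ).symm⟩,
    shear ∘ γ, t, h.shear_comp, (Set.range_comp shear γ).symm, rfl, ?_⟩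
  rw [projHomeo_mk]
  congr 1
  exact (h.hasDerivAt_shear_comp t).deriv.symm

/-- The continuous function `[x : y] ↦ xy / (x² + y²)` on the projective line. -/
def projSlope : ProjLine → ℝ :=
  Projectivization.lift (fun v : {v : Plane // v ≠ 0} =>
    v.1.1 * v.1.2 / (v.1.1 ^ 2 + v.1.2 ^ 2)) (by
      rintro ⟨a, ha⟩ ⟨b, hb⟩ c (rfl : a = c • b)
      have hc : c ≠ 0 := fun hc => ha (by simp [hc])
      have hc2 : c ^ 2 ≠ 0 := pow_ne_zero 2 hc
      simp only [Prod.smul_fst, Prod.smul_snd, smul_eq_mul]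
      rw [← mul_div_mul_left (b.1 * b.2) _ hc2]
      congr 1 <;> ring)

lemma projSlope_mk (v : Plane) (hv : v ≠ 0) :
    projSlope (Projectivization.mk ℝ v hv) = v.1 * v.2 / (v.1 ^ 2 + v.2 ^ 2) := rfl

lemma continuous_projSlope : Continuous projSlope := by
  refine Continuous.quotient_lift ?_ _
  have h : ∀ v : {v : Plane // v ≠ 0}, v.1.1 ^ 2 + v.1.2 ^ 2 ≠ 0 := by
    rintro ⟨v, hv⟩ h
    refine hv (Prod.ext ?_ ?_) <;> simp only [Prod.fst_zero, Prod.snd_zero] <;> nlinarith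
  fun_prop (disch := exact h _)

/-- There is an element of `Homeo¹(ℝ²)` whose induced map on the projective tangent
bundle is not continuous. -/
theorem exists_noncontinuous_induced_bundle_map :
    ∃ (f : Plane ≃ₜ Plane) (φ : Plane → (ProjLine ≃ₜ ProjLine)),
      InHomeo1 f ∧ (∀ q : Plane, InducesAt ⇑f q (φ q)) ∧
      ¬ Continuous (fun x : Plane × ProjLine => ((f x.1, φ x.1 x.2) : Plane × ProjLine)) := by
  refine ⟨shearHomeo, fun q => projHomeo (shearDeriv q), inHomeo1_shearHomeo,
    inducesAt_shear, fun hcont => ?_⟩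
  have hd : ((1, 1) : Plane) ≠ 0 := by simp
  have hline : Continuous fun x : ℝ =>
      (((x, 0), Projectivization.mk ℝ (1, 1) hd) : Plane × ProjLine) := by fun_prop
  have hc := continuous_projSlope.comp (continuous_snd.comp (hcont.comp hline))
  have hval : ∀ x : ℝ, (projSlope ∘ Prod.snd ∘
      (fun x : Plane × ProjLine =>
        ((shearHomeo x.1, projHomeo (shearDeriv x.1) x.2) : Plane × ProjLine)) ∘
      fun x : ℝ => (((x, 0), Projectivization.mk ℝ (1, 1) hd) : Plane × ProjLine)) x =
      (1 + bumpY (x, 0)) / (1 + (1 + bumpY (x, 0)) ^ 2) := fun x => by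
    simp only [Function.comp_apply, projHomeo_mk, projSlope_mk, shearDeriv_apply]
    simp [bumpX]
  have h0 := (hc.tendsto 0).mono_left (nhdsWithin_le_nhds (s := {0}ᶜ))
  rw [hval] at h0
  have h1 : ∀ x : ℝ, x ≠ 0 → bumpY (x, 0) = 1 / 2 := fun x hx => by
    simp only [bumpY]
    field_simp
    ring
  have h2 : Tendsto (fun _ : ℝ => (6 / 13 : ℝ)) (𝓝[≠] 0)
      (𝓝 ((1 + bumpY (0, 0)) / (1 + (1 + bumpY (0, 0)) ^ 2))) := by
    refine h0.congr' ?_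
    filter_upwards [self_mem_nhdsWithin] with x hx
    rw [hval, h1 x hx]
    norm_num
  have h3 := tendsto_nhds_unique h2 tendsto_const_nhds
  norm_num [bumpY] at h3
end
end
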